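/- arXiv:1710.01287 — 2 statements merged into one kernel-verified Lean document; each statement's English description precedes it below -/
import Mathlib

section
/- Let V and W be finite-dimensional normed complex vector spaces. Let P = { (μ,ν) ∈ V × W : μ = 0 ↔ ν = 0 }, with the subspace topology, and define the equivalence relation (μ,ν) ~ (μ',ν') iff there exists λ ∈ ℂ, λ ≠ 0, with μ' = λ⁻¹ • μ and ν' = λ • ν. Then the quotient space P/~ with the quotient topology is Hausdorff. -/
/-- The locus `P = {(μ, ν) ∈ V × W | μ = 0 ↔ ν = 0}`. -/
def polystablePairs (V W : Type*) [AddCommGroup V] [Module ℂ V]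
    [AddCommGroup W] [Module ℂ W] : Type _ :=
  {x : V × W // x.1 = 0 ↔ x.2 = 0}

/-- The relation `(μ, ν) ~ (μ', ν') ↔ ∃ λ ≠ 0, μ' = λ⁻¹ • μ ∧ ν' = λ • ν` on `P`. -/
def scalingOrbitRel {V W : Type*} [AddCommGroup V] [Module ℂ V]
    [AddCommGroup W] [Module ℂ W] (p q : polystablePairs V W) : Prop :=
  ∃ c : ℂ, c ≠ 0 ∧ q.val.1 = c⁻¹ • p.val.1 ∧ q.val.2 = c • p.val.2

instance polystablePairsTop (V W : Type*) [NormedAddCommGroup V] [NormedSpace ℂ V]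
    [NormedAddCommGroup W] [NormedSpace ℂ W] : TopologicalSpace (polystablePairs V W) :=
  instTopologicalSpaceSubtype

/-- The functions `(μ, ν) ↦ f μ * g ν`, for `f` and `g` continuous functionals, are invariant
under scaling and together separate the scaling orbits in `P`. -/
theorem scalingOrbitRel_iff_forall_dual_mul {V W : Type*}
    [NormedAddCommGroup V] [NormedSpace ℂ V] [NormedAddCommGroup W] [NormedSpace ℂ W]
    (p q : polystablePairs V W) :
    scalingOrbitRel p q ↔
      ∀ (f : V →L[ℂ] ℂ) (g : W →L[ℂ] ℂ), f p.val.1 * g p.val.2 = f q.val.1 * g q.val.2 := by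
  constructor
  · rintro ⟨c, hc, h₁, h₂⟩ f g
    rw [h₁, h₂, map_smul, map_smul, smul_eq_mul, smul_eq_mul]
    field_simp
  · obtain ⟨⟨μ, ν⟩, hp⟩ := p
    obtain ⟨⟨μ', ν'⟩, hq⟩ := q
    intro h
    dsimp only at hp hq h
    by_cases hμ : μ = 0
    · have hν := hp.1 hμ
      have hμ' : μ' = 0 := by
        by_contra hμ'
        obtain ⟨f, hf⟩ := SeparatingDual.exists_eq_one (R := ℂ) hμ'
        obtain ⟨g, hg⟩ := SeparatingDual.exists_eq_one (R := ℂ) (mt hq.2 hμ')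
        simpa [hμ, hf, hg] using h f g
      exact ⟨1, one_ne_zero, by simp [hμ, hμ'], by simp [hν, hq.1 hμ']⟩
    · obtain ⟨f₀, hf₀⟩ := SeparatingDual.exists_eq_one (R := ℂ) hμ
      obtain ⟨g₀, hg₀⟩ := SeparatingDual.exists_eq_one (R := ℂ) (mt hp.2 hμ)
      have h₀ : f₀ μ' * g₀ ν' = 1 := by rw [← h, hf₀, hg₀, one_mul]
      have hc : g₀ ν' ≠ 0 := right_ne_zero_of_mul_eq_one h₀
      refine ⟨g₀ ν', hc, ?_, ?_⟩
      · refine (SeparatingDual.eq_iff_forall_dual_eq (R := ℂ)).2 fun f => ?_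
        have hf := h f g₀
        rw [hg₀, mul_one] at hf
        simp only [map_smul, smul_eq_mul, hf]
        field_simp
      · refine (SeparatingDual.eq_iff_forall_dual_eq (R := ℂ)).2 fun g => ?_
        have hg := h f₀ g
        rw [hf₀, one_mul] at hg
        simp only [map_smul, smul_eq_mul, hg]
        linear_combination (-g ν') * h₀

/-- The quotient of `P = {(μ,ν) : μ = 0 ↔ ν = 0}` (with the subspace
topology from `V × W`) by the scaling relation, with the quotient topology, is
Hausdorff. -/
theorem t2Space_quot_scalingOrbitRel
    {V W : Type*} [NormedAddCommGroup V] [NormedSpace ℂ V] [FiniteDimensional ℂ V]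
    [NormedAddCommGroup W] [NormedSpace ℂ W] [FiniteDimensional ℂ W] :
    T2Space (Quot (scalingOrbitRel (V := V) (W := W))) := by
  let Φ : polystablePairs V W → (V →L[ℂ] ℂ) → (W →L[ℂ] ℂ) → ℂ :=
    fun p f g => f p.val.1 * g p.val.2
  have hΦ : Continuous Φ := by
    have hval : Continuous fun p : polystablePairs V W => p.val := continuous_subtype_val
    fun_prop
  have hrel : ∀ p q, scalingOrbitRel p q → Φ p = Φ q := fun p q h =>
    funext₂ ((scalingOrbitRel_iff_forall_dual_mul p q).1 h)
  refine T2Space.of_injective_continuous (f := Quot.lift Φ hrel) ?_ (continuous_quot_lift hrel hΦ)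
  rintro ⟨p⟩ ⟨q⟩ h
  exact Quot.sound ((scalingOrbitRel_iff_forall_dual_mul p q).2 fun f g => congrFun₂ h f g)
end

section
/- Let R be a commutative ring, n ≥ 1, let λ ∈ R be a unit, and let μ, ν, q₂, q₄, …, q_{2n−2} ∈ R. Let η(ν; q₂,…,q_{2n−2}; μ) denote the (n+1)×n matrix over R whose first row is (0,…,0,ν); whose i-th row, for 2 ≤ i ≤ n, has entry 1 in column i−1, entry q_{2(j−i+1)} in column j for each i ≤ j ≤ n, and 0 elsewhere; and whose (n+1)-st row is (0,…,0,μ). Let g_V be the n×n diagonal matrix with i-th diagonal entry λ^{n+1−2i} (i.e. diag(λ^{n−1}, λ^{n−3}, …, λ^{1−n})) and let g_W be the (n+1)×(n+1) diagonal matrix with first entry λⁿ, i-th entry λ^{n+2−2i} for 2 ≤ i ≤ n, and last entry λ^{−n} (i.e. diag(λⁿ, λ^{n−2}, …, λ^{2−n}, λ^{−n})). Then g_W · (λ · η(ν; q₂,…,q_{2n−2}; μ)) · g_V⁻¹ = η(λ^{2n}ν; λ²q₂, λ⁴q₄, …, λ^{2n−2}q_{2n−2}; μ). -/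
open Matrix

/-- The `(n+1) × n` matrix `η(ν; q₂, …, q_{2n-2}; μ)`: first row `(0,…,0,ν)`; for
`2 ≤ i ≤ n` (1-based) the `i`-th row has `1` in column `i-1` and `q_{2(j-i+1)}` in column
`j` for `i ≤ j ≤ n`; last row `(0,…,0,μ)`. Here `q t` stands for `q_{2t}`, and rows and
columns are `0`-based. -/
def higgsEta {R : Type*} [CommRing R] (n : ℕ) (ν μ : R) (q : ℕ → R) :
    Matrix (Fin (n + 1)) (Fin n) R :=
  Matrix.of fun i j =>
    if i.val = 0 then (if j.val = n - 1 then ν else 0)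
    else if i.val = n then (if j.val = n - 1 then μ else 0)
    else if j.val + 1 = i.val then 1
    else if i.val ≤ j.val then q (j.val + 1 - i.val)
    else 0

/-- The inverse of a diagonal matrix with unit entries is the diagonal matrix of inverses. -/
theorem inv_diagonal_units {R ι : Type*} [CommRing R] [Fintype ι] [DecidableEq ι] (d : ι → Rˣ) :
    (Matrix.diagonal fun i => (d i : R))⁻¹ = Matrix.diagonal fun i => (((d i)⁻¹ : Rˣ) : R) :=
  Matrix.inv_eq_right_inv (by simp [Matrix.diagonal_mul_diagonal])

/-- Rescaling the parameters of `higgsEta` multiplies the `(i, j)` entry by `u ^ (2 (j + 1 - i))`. -/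
theorem zpow_mul_higgsEta_apply {R : Type*} [CommRing R] (n : ℕ) (hn : 1 ≤ n) (u : Rˣ) (ν μ : R)
    (q : ℕ → R) (i : Fin (n + 1)) (j : Fin n) :
    ((u ^ (2 * ((j.val : ℤ) + 1 - i.val)) : Rˣ) : R) * higgsEta n ν μ q i j
      = higgsEta n ((u : R) ^ (2 * n) * ν) μ (fun t => (u : R) ^ (2 * t) * q t) i j := by
  have key : ∀ t : ℕ, (j.val : ℤ) + 1 - i.val = t →
      ((u ^ (2 * ((j.val : ℤ) + 1 - i.val)) : Rˣ) : R) = (u : R) ^ (2 * t) := by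
    intro t ht
    rw [ht, ← Units.val_pow_eq_pow_val, ← zpow_natCast]
    norm_cast
  simp only [higgsEta, Matrix.of_apply]
  split_ifs
  · rw [key n (by lia)]
  · exact mul_zero _
  · rw [key 0 (by lia), mul_zero, pow_zero, one_mul]
  · exact mul_zero _
  · rw [key 0 (by lia), mul_zero, pow_zero, one_mul]
  · rw [key (j.val + 1 - i.val) (by lia)]
  · exact mul_zero _

/-- For a unit `λ = u` in a commutative ring `R`, conjugating
`λ • η(ν; q₂,…,q_{2n-2}; μ)` by the diagonal gauge transformations
`g_W = diag(λⁿ, λ^{n-2}, …, λ^{2-n}, λ^{-n})` and `g_V = diag(λ^{n-1}, λ^{n-3}, …, λ^{1-n})`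
rescales the parameters: `g_W · (λ • η) · g_V⁻¹ = η(λ^{2n}ν; λ²q₂, …, λ^{2n-2}q_{2n-2}; μ)`. -/
theorem higgsEta_scaling_gauge
    {R : Type*} [CommRing R] (n : ℕ) (hn : 1 ≤ n) (u : Rˣ) (ν μ : R) (q : ℕ → R) :
    Matrix.diagonal (fun i : Fin (n + 1) => ((u ^ ((n : ℤ) - 2 * (i.val : ℤ)) : Rˣ) : R))
        * ((u : R) • higgsEta n ν μ q)
        * (Matrix.diagonal
            (fun i : Fin n => ((u ^ ((n : ℤ) - 1 - 2 * (i.val : ℤ)) : Rˣ) : R)))⁻¹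
      = higgsEta n ((u : R) ^ (2 * n) * ν) μ (fun t => (u : R) ^ (2 * t) * q t) := by
  rw [inv_diagonal_units]
  ext i j
  rw [mul_diagonal, diagonal_mul, Matrix.smul_apply, smul_eq_mul,
    ← zpow_mul_higgsEta_apply n hn u ν μ q i j]
  have hu : (u ^ (2 * ((j.val : ℤ) + 1 - i.val)) : Rˣ)
      = u ^ ((n : ℤ) - 2 * i.val) * u * (u ^ ((n : ℤ) - 1 - 2 * j.val))⁻¹ := by
    rw [← _root_.zpow_neg, ← _root_.zpow_add_one, ← _root_.zpow_add]
    congr 1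
    ring
  rw [hu, Units.val_mul, Units.val_mul]
  ring
end
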